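/- arXiv:1308.4230 — 7 statements merged into one kernel-verified Lean document; each statement's English description precedes it below -/
import Mathlib

section
/- Assume each w_i is bi-Lipschitz (i.e. w_i and w_i^{-1} are Lipschitz). Then the Hausdorff dimension of the fast basin equals that of the attractor, dimH(B̂) = dimH(A). -/
open Set Metric Filter Topology

namespace FastBasinPaper

variable {X : Type*} [MetricSpace X]

/-- The Hutchinson operator of the IFS `w`. -/
def Hutch {N : ℕ} (w : Fin N → X ≃ₜ X) (S : Set X) : Set X := ⋃ i, (w i) '' S

/-- The (large) inverse-image operation `W⁻¹ : S ↦ ⋃ᵢ wᵢ⁻¹(S)`. -/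
def HutchInv {N : ℕ} (w : Fin N → X ≃ₜ X) (S : Set X) : Set X := ⋃ i, (w i) ⁻¹' S

/-- `A` is a strict attractor of the IFS `w`: a nonempty compact set such that for some
open `U ⊇ A`, `W^k(S) → A` in the Hausdorff metric for every nonempty compact `S ⊆ U`. -/
def IsStrictAttractor {N : ℕ} (w : Fin N → X ≃ₜ X) (A : Set X) : Prop :=
  A.Nonempty ∧ IsCompact A ∧ ∃ U : Set X, IsOpen U ∧ A ⊆ U ∧
    ∀ S : Set X, S.Nonempty → IsCompact S → S ⊆ U →
      Tendsto (fun k => hausdorffDist ((Hutch w)^[k] S) A) atTop (𝓝 0)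

/-- The basin of the attractor `A`: the largest open set witnessing the attraction. -/
def AttractorBasin {N : ℕ} (w : Fin N → X ≃ₜ X) (A : Set X) : Set X :=
  ⋃₀ {U : Set X | IsOpen U ∧ A ⊆ U ∧
    ∀ S : Set X, S.Nonempty → IsCompact S → S ⊆ U →
      Tendsto (fun k => hausdorffDist ((Hutch w)^[k] S) A) atTop (𝓝 0)}

/-- The fast basin of the attractor `A`. -/
def fastBasin {N : ℕ} (w : Fin N → X ≃ₜ X) (A : Set X) : Set X :=
  {x | ∃ k : ℕ, ((Hutch w)^[k] {x} ∩ A).Nonempty}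

/-- `w_{θ₁}⁻¹ ∘ ⋯ ∘ w_{θ_k}⁻¹` (with `θ_j = θ (j-1)`). -/
def invIter {N : ℕ} (w : Fin N → X ≃ₜ X) (θ : ℕ → Fin N) : ℕ → X → X
  | 0 => id
  | k + 1 => invIter w θ k ∘ (w (θ k)).symm

/-- The fractal continuation of `A` along the infinite word `θ`:
`⋃ₖ w_{θ₁}⁻¹ ∘ ⋯ ∘ w_{θ_k}⁻¹ (A)`. -/
def continuation {N : ℕ} (w : Fin N → X ≃ₜ X) (θ : ℕ → Fin N) (A : Set X) : Set X :=
  ⋃ k, invIter w θ k '' A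

/-- `w_{θ_k} ∘ ⋯ ∘ w_{θ₁}` (with `θ_j = θ (j-1)`). -/
def revIter {N : ℕ} (w : Fin N → X ≃ₜ X) (θ : ℕ → Fin N) : ℕ → X → X
  | 0 => id
  | k + 1 => (w (θ k)) ∘ revIter w θ k

/-- `w_{θ₁} ∘ ⋯ ∘ w_{θ_k}` for a finite word `[θ₁, …, θ_k]`. -/
def wordComp {N : ℕ} (w : Fin N → X ≃ₜ X) : List (Fin N) → X → X
  | [] => id
  | i :: t => (w i) ∘ wordComp w t

/-- `w_{θ_k} ∘ ⋯ ∘ w_{θ₁}` for a finite word `[θ₁, …, θ_k]`; the set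
`(revComp w l) ⁻¹' S` is the paper's `w_{θ₁..θ_k}⁻¹(S) = {x : w_{θ_k} ∘ ⋯ ∘ w_{θ₁}(x) ∈ S}`. -/
def revComp {N : ℕ} (w : Fin N → X ≃ₜ X) : List (Fin N) → X → X
  | [] => id
  | i :: t => revComp w t ∘ (w i)

/-- The slow basin of the attractor `A`: points `x` admitting an infinite word `θ` with
`d(w_{θ_n} ∘ ⋯ ∘ w_{θ₁}(x), A) → 0`. -/
def slowBasin {N : ℕ} (w : Fin N → X ≃ₜ X) (A : Set X) : Set X :=
  {x | ∃ θ : ℕ → Fin N, Tendsto (fun n => infDist (revIter w θ n x) A) atTop (𝓝 0)}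

/-- A porous subset of a metric space. -/
def Porous (S : Set X) : Prop :=
  ∃ lam : ℝ, 0 < lam ∧ lam < 1 ∧ ∃ r₀ : ℝ, 0 < r₀ ∧ ∀ s ∈ S, ∀ r : ℝ, 0 < r → r < r₀ →
    ∃ x : X, ball x (lam * r) ⊆ ball s r \ S

/-- A σ-porous subset of a metric space: a countable union of porous sets. -/
def SigmaPorous (S : Set X) : Prop :=
  ∃ f : ℕ → Set X, (∀ n, Porous (f n)) ∧ S = ⋃ n, f n

/-- Every point of `W^k(S)` is the image of a point of `S` under some finite composition of the
maps of the IFS. -/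
lemma exists_revComp_eq_of_mem_iterate_Hutch {X : Type*} [MetricSpace X] {N : ℕ}
    (w : Fin N → X ≃ₜ X) {k : ℕ} {S : Set X} {y : X} (hy : y ∈ (Hutch w)^[k] S) :
    ∃ l : List (Fin N), ∃ s ∈ S, revComp w l s = y := by
  induction k generalizing S with
  | zero => exact ⟨[], y, hy, rfl⟩
  | succ k ih =>
    rw [Function.iterate_succ_apply] at hy
    obtain ⟨l, z, hz, rfl⟩ := ih hy
    obtain ⟨i, s, hs, rfl⟩ := mem_iUnion.mp hz
    exact ⟨i :: l, s, hs, rfl⟩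

lemma fastBasin_subset_iUnion_preimage_revComp {X : Type*} [MetricSpace X] {N : ℕ}
    (w : Fin N → X ≃ₜ X) (A : Set X) :
    fastBasin w A ⊆ ⋃ l : List (Fin N), revComp w l ⁻¹' A := by
  rintro x ⟨k, y, hy, hyA⟩
  obtain ⟨l, s, rfl, rfl⟩ := exists_revComp_eq_of_mem_iterate_Hutch w hy
  exact mem_iUnion.mpr ⟨l, hyA⟩

lemma subset_fastBasin {X : Type*} [MetricSpace X] {N : ℕ} (w : Fin N → X ≃ₜ X) (A : Set X) :
    A ⊆ fastBasin w A :=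
  fun x hx => ⟨0, x, rfl, hx⟩

lemma exists_antilipschitzWith_revComp {X : Type*} [MetricSpace X] {N : ℕ} (w : Fin N → X ≃ₜ X)
    (hw : ∀ i, ∃ K : NNReal, LipschitzWith K (w i).symm) (l : List (Fin N)) :
    ∃ K : NNReal, AntilipschitzWith K (revComp w l) := by
  induction l with
  | nil => exact ⟨1, AntilipschitzWith.id⟩
  | cons i t ih =>
    obtain ⟨K, hK⟩ := ih
    obtain ⟨K', hK'⟩ := hw i
    exact ⟨K' * K, hK.comp (hK'.to_rightInverse (w i).symm_apply_apply)⟩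

/-- if each `wᵢ` is bi-Lipschitz, then the fast basin has the same Hausdorff
dimension as the attractor. -/
theorem statement3 {X : Type*} [MetricSpace X] [CompleteSpace X] {N : ℕ} (hN : 0 < N)
    (w : Fin N → X ≃ₜ X) (A : Set X) (hA : IsStrictAttractor w A)
    (hbl : ∀ i, ∃ K K' : NNReal, LipschitzWith K (w i) ∧ LipschitzWith K' (w i).symm) :
    dimH (fastBasin w A) = dimH A := by
  refine le_antisymm ?_ (dimH_mono (subset_fastBasin w A))
  refine (dimH_mono (fastBasin_subset_iUnion_preimage_revComp w A)).trans ?_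
  rw [dimH_iUnion]
  refine iSup_le fun l => ?_
  obtain ⟨K, hK⟩ := exists_antilipschitzWith_revComp w
    (fun i => let ⟨_, K', _, h⟩ := hbl i; ⟨K', h⟩) l
  exact hK.dimH_preimage_le A
end FastBasinPaper
end

section
/- If the strict attractor A of 𝒲 is connected, then for every infinite word ϑ ∈ {1,…,N}^∞ the fractal continuation B̂(ϑ) is connected, and the fast basin B̂ is connected. -/
open Set Metric Filter Topology

namespace FastBasinPaper

variable {X : Type*} [MetricSpace X]

theorem nonempty_Hutch_iterate {N : ℕ} (hN : 0 < N) (w : Fin N → X ≃ₜ X) {S : Set X}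
    (hS : S.Nonempty) (k : ℕ) : ((Hutch w)^[k] S).Nonempty := by
  induction k with
  | zero => exact hS
  | succ k ih =>
    rw [Function.iterate_succ_apply']
    obtain ⟨x, hx⟩ := ih
    exact ⟨w ⟨0, hN⟩ x, mem_iUnion.2 ⟨⟨0, hN⟩, x, hx, rfl⟩⟩

theorem isCompact_Hutch_iterate {N : ℕ} (w : Fin N → X ≃ₜ X) {S : Set X}
    (hS : IsCompact S) (k : ℕ) : IsCompact ((Hutch w)^[k] S) := by
  induction k with
  | zero => exact hS
  | succ k ih =>
    rw [Function.iterate_succ_apply']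
    exact isCompact_iUnion fun i => ih.image (w i).continuous

/-- Each map of the IFS sends a strict attractor into itself. -/
theorem IsStrictAttractor.mapsTo {N : ℕ} (hN : 0 < N) {w : Fin N → X ≃ₜ X} {A : Set X}
    (hA : IsStrictAttractor w A) (i : Fin N) : MapsTo (w i) A A := by
  obtain ⟨hne, hcomp, U, -, hAU, hU⟩ := hA
  have hlim := hU A hne hcomp hAU
  have hfin : ∀ k, hausdorffEDist ((Hutch w)^[k] A) A ≠ ⊤ := fun k =>
    hausdorffEDist_ne_top_of_nonempty_of_bounded (nonempty_Hutch_iterate hN w hne k) hne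
      (isCompact_Hutch_iterate w hcomp k).isBounded hcomp.isBounded
  intro a ha
  have hclose : ∀ k, ∃ y ∈ (Hutch w)^[k] A,
      dist a y ≤ hausdorffDist ((Hutch w)^[k] A) A := fun k => by
    obtain ⟨y, hy, hd⟩ := (isCompact_Hutch_iterate w hcomp k).exists_infDist_eq_dist
      (nonempty_Hutch_iterate hN w hne k) a
    refine ⟨y, hy, hd ▸ ?_⟩
    rw [hausdorffDist_comm]
    exact infDist_le_hausdorffDist_of_mem ha (by rw [hausdorffEDist_comm]; exact hfin k)
  choose y hy hd using hclose
  have hya : Tendsto y atTop (𝓝 a) := by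
    rw [tendsto_iff_dist_tendsto_zero]
    exact squeeze_zero (fun _ => dist_nonneg) (fun k => dist_comm a (y k) ▸ hd k) hlim
  have hinf : Tendsto (fun k => infDist (w i (y k)) A) atTop (𝓝 (infDist (w i a) A)) :=
    ((continuous_infDist_pt A).comp (w i).continuous).continuousAt.tendsto.comp hya
  have hzero : Tendsto (fun k => infDist (w i (y k)) A) atTop (𝓝 0) := by
    refine squeeze_zero (fun _ => infDist_nonneg) (fun k => ?_)
      (hlim.comp (tendsto_add_atTop_nat 1))
    refine infDist_le_hausdorffDist_of_mem ?_ (hfin (k + 1))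
    rw [Function.iterate_succ_apply']
    exact mem_iUnion.2 ⟨i, y k, hy k, rfl⟩
  exact (hcomp.isClosed.mem_iff_infDist_zero hne).2 (tendsto_nhds_unique hinf hzero)

theorem continuous_invIter {N : ℕ} (w : Fin N → X ≃ₜ X) (θ : ℕ → Fin N) (k : ℕ) :
    Continuous (invIter w θ k) := by
  induction k with
  | zero => exact continuous_id
  | succ k ih => exact ih.comp (w (θ k)).symm.continuous

theorem leftInverse_invIter {N : ℕ} (w : Fin N → X ≃ₜ X) (θ : ℕ → Fin N) (k : ℕ) :
    Function.LeftInverse (invIter w θ k) (revIter w θ k) := by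
  induction k with
  | zero => exact fun _ => rfl
  | succ k ih => exact fun x => by simp [invIter, revIter, ih x]

theorem rightInverse_invIter {N : ℕ} (w : Fin N → X ≃ₜ X) (θ : ℕ → Fin N) (k : ℕ) :
    Function.RightInverse (invIter w θ k) (revIter w θ k) := by
  induction k with
  | zero => exact fun _ => rfl
  | succ k ih => exact fun x => by simp [invIter, revIter, ih _]

theorem image_invIter {N : ℕ} (w : Fin N → X ≃ₜ X) (θ : ℕ → Fin N) (k : ℕ) (A : Set X) :
    invIter w θ k '' A = revIter w θ k ⁻¹' A :=
  congrFun (image_eq_preimage_of_inverse (rightInverse_invIter w θ k)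
    (leftInverse_invIter w θ k)) A

theorem mapsTo_revIter {N : ℕ} {w : Fin N → X ≃ₜ X} {A : Set X}
    (h : ∀ i, MapsTo (w i) A A) (θ : ℕ → Fin N) (k : ℕ) : MapsTo (revIter w θ k) A A := by
  induction k with
  | zero => exact mapsTo_id A
  | succ k ih => exact (h (θ k)).comp ih

theorem revIter_congr {N : ℕ} (w : Fin N → X ≃ₜ X) {θ η : ℕ → Fin N} {k : ℕ}
    (h : ∀ j < k, θ j = η j) : revIter w θ k = revIter w η k := by
  induction k with
  | zero => rfl
  | succ k ih =>
    simp only [revIter]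
    rw [ih fun j hj => h j (hj.trans k.lt_succ_self), h k k.lt_succ_self]

theorem mem_Hutch_iterate_singleton {N : ℕ} (hN : 0 < N) (w : Fin N → X ≃ₜ X) {x y : X}
    {k : ℕ} : y ∈ (Hutch w)^[k] {x} ↔ ∃ θ : ℕ → Fin N, revIter w θ k x = y := by
  induction k generalizing y with
  | zero => exact ⟨fun h => ⟨fun _ => ⟨0, hN⟩, Eq.symm h⟩, fun ⟨_, h⟩ => Eq.symm h⟩
  | succ k ih =>
    rw [Function.iterate_succ_apply']
    simp only [Hutch, mem_iUnion, mem_image]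
    constructor
    · rintro ⟨i, z, hz, rfl⟩
      obtain ⟨θ, rfl⟩ := ih.1 hz
      refine ⟨Function.update θ k i, ?_⟩
      have : revIter w (Function.update θ k i) k = revIter w θ k :=
        revIter_congr w fun j hj => Function.update_of_ne hj.ne _ _
      simp [revIter, this]
    · rintro ⟨θ, rfl⟩
      exact ⟨θ k, revIter w θ k x, ih.2 ⟨θ, rfl⟩, rfl⟩

theorem fastBasin_eq_iUnion_continuation {N : ℕ} (hN : 0 < N) (w : Fin N → X ≃ₜ X)
    (A : Set X) : fastBasin w A = ⋃ θ, continuation w θ A := by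
  ext x
  simp only [fastBasin, continuation, image_invIter, mem_iUnion, mem_preimage, mem_ofPred_eq]
  constructor
  · rintro ⟨k, y, hy, hyA⟩
    obtain ⟨θ, rfl⟩ := (mem_Hutch_iterate_singleton hN w).1 hy
    exact ⟨θ, k, hyA⟩
  · rintro ⟨θ, k, h⟩
    exact ⟨k, _, (mem_Hutch_iterate_singleton hN w).2 ⟨θ, rfl⟩, h⟩

/-- if the strict attractor `A` is connected then every fractal continuation
and the fast basin are connected. -/
theorem statement4 {X : Type*} [MetricSpace X] [CompleteSpace X] {N : ℕ} (hN : 0 < N)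
    (w : Fin N → X ≃ₜ X) (A : Set X) (hA : IsStrictAttractor w A)
    (hconn : IsConnected A) :
    (∀ θ : ℕ → Fin N, IsConnected (continuation w θ A)) ∧
    IsConnected (fastBasin w A) := by
  have hmaps := hA.mapsTo hN
  obtain ⟨a, ha⟩ := hconn.nonempty
  have hmem : ∀ θ k, a ∈ invIter w θ k '' A := fun θ k => by
    rw [image_invIter]
    exact mapsTo_revIter hmaps θ k ha
  have hcont : ∀ θ, a ∈ continuation w θ A := fun θ => mem_iUnion.2 ⟨0, hmem θ 0⟩
  have hpre : ∀ θ, IsPreconnected (continuation w θ A) := fun θ =>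
    isPreconnected_iUnion ⟨a, mem_iInter.2 (hmem θ)⟩ fun k =>
      hconn.isPreconnected.image _ (continuous_invIter w θ k).continuousOn
  refine ⟨fun θ => ⟨⟨a, hcont θ⟩, hpre θ⟩, ?_⟩
  rw [fastBasin_eq_iUnion_continuation hN]
  exact ⟨⟨a, mem_iUnion.2 ⟨fun _ => ⟨0, hN⟩, hcont _⟩⟩,
    isPreconnected_iUnion ⟨a, mem_iInter.2 hcont⟩ hpre⟩
end FastBasinPaper
end

section
/- If the strict attractor A of 𝒲 has empty interior, then the fast basin B̂ has empty interior (and consequently every fractal continuation B̂(ϑ) ⊆ B̂ has empty interior). -/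
open Set Metric Filter Topology

namespace FastBasinPaper

variable {X : Type*} [MetricSpace X]

theorem inter_hutchInv_iterate_nonempty {X : Type*} [MetricSpace X] {N : ℕ}
    (w : Fin N → X ≃ₜ X) (S : Set X) (k : ℕ) (A : Set X)
    (h : ((Hutch w)^[k] S ∩ A).Nonempty) : (S ∩ (HutchInv w)^[k] A).Nonempty := by
  induction k generalizing A with
  | zero => exact h
  | succ k ih =>
    rw [Function.iterate_succ_apply'] at h
    obtain ⟨y, hy, hyA⟩ := h
    obtain ⟨i, z, hz, rfl⟩ := mem_iUnion.1 hy
    exact ih (HutchInv w A) ⟨z, hz, mem_iUnion.2 ⟨i, hyA⟩⟩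

theorem isMeagre_hutchInv_iterate {X : Type*} [MetricSpace X] {N : ℕ}
    (w : Fin N → X ≃ₜ X) {A : Set X} (hA : IsMeagre A) (k : ℕ) :
    IsMeagre ((HutchInv w)^[k] A) := by
  induction k with
  | zero => exact hA
  | succ k ih =>
    rw [Function.iterate_succ_apply']
    exact isMeagre_iUnion fun i =>
      ih.preimage_of_isOpenMap (w i).continuous (w i).isOpenMap

theorem isMeagre_fastBasin {X : Type*} [MetricSpace X] {N : ℕ}
    (w : Fin N → X ≃ₜ X) {A : Set X} (hA : IsMeagre A) : IsMeagre (fastBasin w A) := by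
  refine (isMeagre_iUnion fun k => isMeagre_hutchInv_iterate w hA k).mono ?_
  rintro x ⟨k, hk⟩
  obtain ⟨y, rfl, hy⟩ := inter_hutchInv_iterate_nonempty w {x} k A hk
  exact mem_iUnion.2 ⟨k, hy⟩

theorem mem_hutch_iterate_invIter {X : Type*} [MetricSpace X] {N : ℕ}
    (w : Fin N → X ≃ₜ X) (θ : ℕ → Fin N) (k : ℕ) (a : X) :
    a ∈ (Hutch w)^[k] {invIter w θ k a} := by
  induction k generalizing a with
  | zero => exact rfl
  | succ k ih =>
    rw [Function.iterate_succ_apply']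
    exact mem_iUnion.2 ⟨θ k, (w (θ k)).symm a, ih _, (w (θ k)).apply_symm_apply a⟩

theorem continuation_subset_fastBasin {X : Type*} [MetricSpace X] {N : ℕ}
    (w : Fin N → X ≃ₜ X) (θ : ℕ → Fin N) (A : Set X) :
    continuation w θ A ⊆ fastBasin w A := by
  intro x hx
  obtain ⟨k, a, ha, rfl⟩ := mem_iUnion.1 hx
  exact ⟨k, a, mem_hutch_iterate_invIter w θ k a, ha⟩

/-- if the strict attractor `A` has empty interior, then the fast basin has
empty interior, and consequently so does every fractal continuation. -/
theorem statement6 {X : Type*} [MetricSpace X] [CompleteSpace X] {N : ℕ} (hN : 0 < N)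
    (w : Fin N → X ≃ₜ X) (A : Set X) (hA : IsStrictAttractor w A)
    (hint : interior A = ∅) :
    interior (fastBasin w A) = ∅ ∧
    ∀ θ : ℕ → Fin N, interior (continuation w θ A) = ∅ := by
  have hmeagre : IsMeagre A :=
    (hA.2.1.isClosed.isNowhereDense_iff.2 hint).isMeagre
  have hbasin : interior (fastBasin w A) = ∅ :=
    interior_eq_empty_iff_dense_compl.2 (dense_of_mem_residual (isMeagre_fastBasin w hmeagre))
  exact ⟨hbasin, fun θ => subset_empty_iff.1
    (hbasin ▸ interior_mono (continuation_subset_fastBasin w θ A))⟩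
end FastBasinPaper
end

section
/- Assume each w_i is bi-Lipschitz (i.e. w_i and w_i^{-1} are Lipschitz). If the strict attractor A of 𝒲 is σ-porous, then the fast basin B̂ is σ-porous, and hence every fractal continuation B̂(ϑ) ⊆ B̂ is σ-porous. -/
open Set Metric Filter Topology

namespace FastBasinPaper

variable {X : Type*} [MetricSpace X]

theorem porous_empty {X : Type*} [MetricSpace X] : Porous (∅ : Set X) :=
  ⟨1 / 2, by norm_num, by norm_num, 1, one_pos, fun _ hs => hs.elim⟩

theorem SigmaPorous.iUnion {X ι : Type*} [MetricSpace X] [Countable ι] {S : ι → Set X}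
    (h : ∀ i, SigmaPorous (S i)) : SigmaPorous (⋃ i, S i) := by
  choose f hf hS using h
  rcases isEmpty_or_nonempty ι with hι | hι
  · exact ⟨fun _ => ∅, fun _ => porous_empty, by simp⟩
  · obtain ⟨e, he⟩ := exists_surjective_nat (ι × ℕ)
    refine ⟨fun n => f (e n).1 (e n).2, fun n => hf _ _, ?_⟩
    rw [he.iUnion_comp (fun p : ι × ℕ => f p.1 p.2), iUnion_prod']
    exact iUnion_congr hS

/-- Bi-Lipschitz homeomorphisms preserve porosity. -/
theorem Porous.image {X : Type*} [MetricSpace X] {S : Set X} (hS : Porous S) (h : X ≃ₜ X)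
    {K K' : NNReal} (hK : LipschitzWith K h) (hK' : LipschitzWith K' h.symm) :
    Porous (h '' S) := by
  obtain ⟨lam, hlam, hlam1, r₀, hr₀, H⟩ := hS
  obtain ⟨L, hL, hLip⟩ : ∃ L : ℝ, 1 ≤ L ∧ ∀ x y, dist (h x) (h y) ≤ L * dist x y :=
    ⟨max 1 K, le_max_left _ _, fun x y => (hK.dist_le_mul x y).trans
      (mul_le_mul_of_nonneg_right (le_max_right _ _) dist_nonneg)⟩
  obtain ⟨L', hL', hLip'⟩ :
      ∃ L : ℝ, 1 ≤ L ∧ ∀ x y, dist (h.symm x) (h.symm y) ≤ L * dist x y :=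
    ⟨max 1 K', le_max_left _ _, fun x y => (hK'.dist_le_mul x y).trans
      (mul_le_mul_of_nonneg_right (le_max_right _ _) dist_nonneg)⟩
  have hL0 : 0 < L := by linarith
  have hL0' : 0 < L' := by linarith
  refine ⟨lam / (L * L'), by positivity,
    (div_le_self hlam.le (one_le_mul_of_one_le_of_one_le hL hL')).trans_lt hlam1, r₀, hr₀, ?_⟩
  rintro _ ⟨s, hs, rfl⟩ r hr hrr
  obtain ⟨x, hx⟩ := H s hs (r / L) (by positivity) ((div_le_self hr.le hL).trans_lt hrr)
  refine ⟨h x, fun y hy => ?_⟩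
  have hmem : h.symm y ∈ ball x (lam * (r / L)) := by
    rw [mem_ball] at hy ⊢
    have hdist := hLip' y (h x)
    rw [h.symm_apply_apply] at hdist
    calc dist (h.symm y) x ≤ L' * dist y (h x) := hdist
      _ < L' * (lam / (L * L') * r) := by gcongr
      _ = lam * (r / L) := by field_simp
  obtain ⟨hball, hnot⟩ := hx hmem
  refine ⟨?_, ?_⟩
  · rw [mem_ball] at hball ⊢
    have hdist := hLip (h.symm y) s
    rw [h.apply_symm_apply] at hdist
    calc dist y (h s) ≤ L * dist (h.symm y) s := hdist
      _ < L * (r / L) := by gcongr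
      _ = r := by field_simp
  · rintro ⟨z, hz, rfl⟩
    exact hnot (by simpa using hz)

theorem SigmaPorous.image {X : Type*} [MetricSpace X] {S : Set X} (hS : SigmaPorous S)
    (h : X ≃ₜ X) {K K' : NNReal} (hK : LipschitzWith K h) (hK' : LipschitzWith K' h.symm) :
    SigmaPorous (h '' S) := by
  obtain ⟨f, hf, rfl⟩ := hS
  exact ⟨fun n => h '' f n, fun n => (hf n).image h hK hK', image_iUnion⟩

theorem hutch_inter_nonempty_iff {X : Type*} [MetricSpace X] {N : ℕ} (w : Fin N → X ≃ₜ X)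
    (S T : Set X) : (Hutch w S ∩ T).Nonempty ↔ (S ∩ HutchInv w T).Nonempty := by
  simp only [Set.Nonempty, Hutch, HutchInv, mem_inter_iff, mem_iUnion, mem_image, mem_preimage]
  constructor
  · rintro ⟨_, ⟨i, x, hx, rfl⟩, hT⟩
    exact ⟨x, hx, i, hT⟩
  · rintro ⟨x, hx, i, hT⟩
    exact ⟨w i x, ⟨i, x, hx, rfl⟩, hT⟩

theorem iterate_hutch_inter_nonempty_iff {X : Type*} [MetricSpace X] {N : ℕ}
    (w : Fin N → X ≃ₜ X) (k : ℕ) (S T : Set X) :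
    ((Hutch w)^[k] S ∩ T).Nonempty ↔ (S ∩ (HutchInv w)^[k] T).Nonempty := by
  induction k generalizing T with
  | zero => rfl
  | succ k ih =>
    rw [Function.iterate_succ_apply', hutch_inter_nonempty_iff, ih, Function.iterate_succ_apply]

theorem fastBasin_eq_iUnion {X : Type*} [MetricSpace X] {N : ℕ} (w : Fin N → X ≃ₜ X)
    (A : Set X) : fastBasin w A = ⋃ k, (HutchInv w)^[k] A := by
  ext x
  simp only [fastBasin, mem_ofPred_eq, iterate_hutch_inter_nonempty_iff, mem_iUnion,
    singleton_inter_nonempty]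

/-- if each `wᵢ` is bi-Lipschitz and the strict attractor `A` is σ-porous,
then the fast basin is σ-porous, and hence so is every fractal continuation. -/
theorem statement7 {X : Type*} [MetricSpace X] [CompleteSpace X] {N : ℕ} (hN : 0 < N)
    (w : Fin N → X ≃ₜ X) (A : Set X) (hA : IsStrictAttractor w A)
    (hbl : ∀ i, ∃ K K' : NNReal, LipschitzWith K (w i) ∧ LipschitzWith K' (w i).symm)
    (hpor : SigmaPorous A) :
    SigmaPorous (fastBasin w A) ∧
    ∀ θ : ℕ → Fin N, SigmaPorous (continuation w θ A) := by
  have himage (i : Fin N) {S : Set X} (hS : SigmaPorous S) : SigmaPorous ((w i).symm '' S) := by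
    obtain ⟨K, K', hK, hK'⟩ := hbl i
    exact hS.image (w i).symm hK' hK
  refine ⟨?_, fun θ => SigmaPorous.iUnion fun k => ?_⟩
  · rw [fastBasin_eq_iUnion]
    refine SigmaPorous.iUnion fun k => ?_
    induction k with
    | zero => exact hpor
    | succ k ih =>
      rw [Function.iterate_succ_apply']
      refine SigmaPorous.iUnion fun i => ?_
      rw [← (w i).image_symm]
      exact himage i ih
  · have hiter : ∀ S : Set X, SigmaPorous S → SigmaPorous (invIter w θ k '' S) := by
      induction k with
      | zero => intro S hS; simpa [invIter] using hS
      | succ k ih =>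
        intro S hS
        rw [invIter, image_comp]
        exact ih _ (himage _ hS)
    exact hiter A hpor
end FastBasinPaper
end

section
/- Assume each inverse map w_i^{-1} is L-expansive for some L > 1, i.e. d(w_i^{-1}(y_1), w_i^{-1}(y_2)) ≥ L·d(y_1,y_2) for all y_1,y_2 ∈ X. Let x_0 ∈ X and 1 < L̃ < L. Then there exists r_0 > 0 such that for every reverse trajectory (y_n)_{n≥0} (i.e. y_{n+1} = w_{θ_{n+1}}^{-1}(y_n) for some indices θ_{n+1} ∈ {1,…,N}): if d(y_m, x_0) > r_0 for some m, then d(y_{n+m}, x_0) ≥ L̃^n · d(y_m, x_0) for all n ≥ 0. -/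
open Set Metric Filter Topology

namespace FastBasinPaper

variable {X : Type*} [MetricSpace X]

/-- One step of a map that expands by `L` increases the distance to `x₀` by a factor `K < L`,
once that distance is large compared with the displacement of `x₀`. -/
theorem mul_dist_le_dist_of_expansive {f : X → X} {L K C : ℝ}
    (hf : ∀ y₁ y₂, L * dist y₁ y₂ ≤ dist (f y₁) (f y₂)) {x₀ y : X}
    (hC : dist (f x₀) x₀ ≤ C) (hKL : K < L) (hy : C / (L - K) ≤ dist y x₀) :
    K * dist y x₀ ≤ dist (f y) x₀ := by
  have hCy := (div_le_iff₀ (sub_pos.mpr hKL)).mp hy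
  have htri := dist_triangle_right (f y) (f x₀) x₀
  linarith [hf y x₀]

/-- if each inverse map `wᵢ⁻¹` is `L`-expansive with `L > 1`, then for every
`x₀ ∈ X` and `1 < L̃ < L` there is `r₀ > 0` such that along every reverse trajectory `(yₙ)`,
if `d(y_m, x₀) > r₀` then `d(y_{n+m}, x₀) ≥ L̃ⁿ · d(y_m, x₀)` for all `n`. -/
theorem statement13 {X : Type*} [MetricSpace X] [CompleteSpace X] {N : ℕ} (hN : 0 < N)
    (w : Fin N → X ≃ₜ X) (L : ℝ) (hL : 1 < L)
    (hexp : ∀ (i : Fin N) (y₁ y₂ : X),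
      L * dist y₁ y₂ ≤ dist ((w i).symm y₁) ((w i).symm y₂))
    (x₀ : X) (Lt : ℝ) (hLt₁ : 1 < Lt) (hLt₂ : Lt < L) :
    ∃ r₀ > 0, ∀ (θ : ℕ → Fin N) (y : ℕ → X),
      (∀ n, y (n + 1) = (w (θ n)).symm (y n)) →
      ∀ m, r₀ < dist (y m) x₀ →
      ∀ n, Lt ^ n * dist (y m) x₀ ≤ dist (y (n + m)) x₀ := by
  set C := ∑ i, dist ((w i).symm x₀) x₀
  have hC : ∀ i, dist ((w i).symm x₀) x₀ ≤ C := fun i =>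
    Finset.single_le_sum (f := fun i => dist ((w i).symm x₀) x₀)
      (fun _ _ => dist_nonneg) (Finset.mem_univ i)
  have hC0 : 0 ≤ C := Finset.sum_nonneg fun _ _ => dist_nonneg
  have hLLt : 0 < L - Lt := sub_pos.mpr hLt₂
  refine ⟨C / (L - Lt) + 1, by positivity, fun θ y hy m hm n => ?_⟩
  induction n with
  | zero => simp
  | succ n ih =>
    have hgrow : dist (y m) x₀ ≤ dist (y (n + m)) x₀ :=
      (le_mul_of_one_le_left dist_nonneg (one_le_pow₀ hLt₁.le)).trans ih
    have hstep := mul_dist_le_dist_of_expansive (hexp (θ (n + m))) (hC _) hLt₂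
      (y := y (n + m)) (by linarith)
    rw [← hy, show n + m + 1 = n + 1 + m by ring] at hstep
    calc Lt ^ (n + 1) * dist (y m) x₀ = Lt * (Lt ^ n * dist (y m) x₀) := by ring
      _ ≤ Lt * dist (y (n + m)) x₀ := by gcongr
      _ ≤ dist (y (n + 1 + m)) x₀ := hstep
end FastBasinPaper
end

section
/- If X is a metric space in which every open ball is path connected, and the strict attractor A of 𝒲 is connected, then the slow basin B̃ is path connected. -/
open Set Metric Filter Topology

namespace FastBasinPaper

variable {X : Type*} [MetricSpace X]

section Helpers

variable {N : ℕ}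

lemma revIter_add (w : Fin N → X ≃ₜ X) (θ : ℕ → Fin N) (n m : ℕ) (x : X) :
    revIter w θ (m + n) x = revIter w (fun j => θ (j + n)) m (revIter w θ n x) := by
  induction m with
  | zero => simp [revIter]
  | succ m ih => simp only [Nat.succ_add, revIter, Function.comp_apply, ih]

lemma revIter_mem_iterate_hutch (w : Fin N → X ≃ₜ X) (θ : ℕ → Fin N) (x : X) (n : ℕ) :
    revIter w θ n x ∈ (Hutch w)^[n] {x} := by
  induction n with
  | zero => simp [revIter]
  | succ n ih =>
    rw [Function.iterate_succ_apply']
    exact mem_iUnion.2 ⟨θ n, mem_image_of_mem _ ih⟩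

lemma finite_iterate_hutch (w : Fin N → X ≃ₜ X) {S : Set X} (hS : S.Finite) (n : ℕ) :
    ((Hutch w)^[n] S).Finite := by
  induction n with
  | zero => exact hS
  | succ n ih =>
    rw [Function.iterate_succ_apply']
    exact finite_iUnion fun i => ih.image _

lemma isPathConnected_revIter_preimage (w : Fin N → X ≃ₜ X) (θ : ℕ → Fin N) (n : ℕ) {S : Set X}
    (hS : IsPathConnected S) : IsPathConnected (revIter w θ n ⁻¹' S) := by
  induction n generalizing S with
  | zero => exact hS
  | succ n ih => exact ih ((w (θ n)).isPathConnected_preimage.2 hS)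

/-- Every word drives a point attracted to `A` towards `A`. -/
lemma tendsto_infDist_revIter {w : Fin N → X ≃ₜ X} {A : Set X} (hne : A.Nonempty)
    (hA : IsCompact A) {x : X}
    (hx : Tendsto (fun k => hausdorffDist ((Hutch w)^[k] {x}) A) atTop (𝓝 0)) (θ : ℕ → Fin N) :
    Tendsto (fun n => infDist (revIter w θ n x) A) atTop (𝓝 0) := by
  refine squeeze_zero (fun _ => infDist_nonneg) (fun n => ?_) hx
  have hmem := revIter_mem_iterate_hutch w θ x n
  exact infDist_le_hausdorffDist_of_mem hmem
    (hausdorffEDist_ne_top_of_nonempty_of_bounded ⟨_, hmem⟩ hne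
      (finite_iterate_hutch w (finite_singleton x) n).isBounded hA.isBounded)

lemma mem_slowBasin_of_revIter {w : Fin N → X ≃ₜ X} {A : Set X} {x : X} (θ : ℕ → Fin N) (n : ℕ)
    (h : Tendsto (fun m => infDist (revIter w (fun j => θ (j + n)) m (revIter w θ n x)) A)
      atTop (𝓝 0)) : x ∈ slowBasin w A := by
  refine ⟨θ, (tendsto_add_atTop_iff_nat n).1 ?_⟩
  simpa only [revIter_add] using h

lemma isPathConnected_thickening
    (hball : ∀ (x : X) (r : ℝ), 0 < r → IsPathConnected (ball x r)) {A : Set X}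
    (hA : IsConnected A) {ε : ℝ} (hε : 0 < ε) : IsPathConnected (thickening ε A) := by
  have : LocallyPathConnectedSpace X :=
    .of_bases (fun x => nhds_basis_ball) (fun x r hr => hball x r hr)
  rw [← isOpen_thickening.isConnected_iff_isPathConnected]
  have hsub : A ⊆ thickening ε A := self_subset_thickening hε A
  obtain ⟨a, ha⟩ := hA.nonempty
  refine ⟨⟨a, hsub ha⟩, isPreconnected_of_forall a fun y hy => ?_⟩
  obtain ⟨b, hb, hyb⟩ := mem_thickening_iff.1 hy
  exact ⟨A ∪ ball b ε, union_subset hsub (ball_subset_thickening hb ε), Or.inl ha, Or.inr hyb,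
    hA.isPreconnected.union b hb (mem_ball_self hε)
      (hball b ε hε).isConnected.isPreconnected⟩

end Helpers

/-- if every open ball of `X` is path connected and the strict attractor `A`
is connected, then the slow basin is path connected. -/
theorem statement17 {X : Type*} [MetricSpace X] [CompleteSpace X] {N : ℕ} (hN : 0 < N)
    (hball : ∀ (x : X) (r : ℝ), 0 < r → IsPathConnected (ball x r))
    (w : Fin N → X ≃ₜ X) (A : Set X) (hA : IsStrictAttractor w A)
    (hconn : IsConnected A) :
    IsPathConnected (slowBasin w A) := by
  obtain ⟨⟨a, ha⟩, hcomp, U, hUo, hAU, hU⟩ := hA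
  obtain ⟨ε, hε, hεU⟩ := hcomp.exists_thickening_subset_open hUo hAU
  have hattr : ∀ x ∈ U, ∀ θ : ℕ → Fin N,
      Tendsto (fun n => infDist (revIter w θ n x) A) atTop (𝓝 0) := fun x hx θ =>
    tendsto_infDist_revIter ⟨a, ha⟩ hcomp
      (hU {x} (singleton_nonempty x) isCompact_singleton (singleton_subset_iff.2 hx)) θ
  refine ⟨a, ⟨fun _ => ⟨0, hN⟩, hattr a (hAU ha) _⟩, fun {x} hx => ?_⟩
  obtain ⟨θ, hθ⟩ := hx
  obtain ⟨n, hna, hnx⟩ := (((hattr a (hAU ha) θ).eventually_lt_const hε).and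
    (hθ.eventually_lt_const hε)).exists
  have hmem : ∀ y, infDist (revIter w θ n y) A < ε → y ∈ revIter w θ n ⁻¹' thickening ε A :=
    fun y hy => (mem_thickening_iff_infDist_lt ⟨a, ha⟩).2 hy
  exact ((isPathConnected_revIter_preimage w θ n
    (isPathConnected_thickening hball hconn hε)).joinedIn a (hmem a hna) x (hmem x hnx)).mono
    fun y hy => mem_slowBasin_of_revIter θ n (hattr _ (hεU hy) _)
end FastBasinPaper
end

section
/- Let X be a nonempty compact metric space and h : X → X a homeomorphism such that X is a minimal invariant set (i.e., every nonempty compact S ⊆ X with h(S) = S equals X); equivalently, the forward orbit of every point is dense in X. Then the IFS 𝒲 = {X; e, h}, where e is the identity map, has strict attractor A = X with basin B(A) = X: for every nonempty compact S ⊆ X, the sets W^k(S) = ⋃_{0 ≤ m ≤ k} h^m(S) converge to X in the Hausdorff metric. -/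
open Set Metric Filter Topology

namespace FastBasinPaper

variable {X : Type*} [MetricSpace X]

/-- A nonempty compact forward invariant set of a minimal homeomorphism is the whole space. -/
theorem eq_univ_of_image_subset {X : Type*} [MetricSpace X] (h : X ≃ₜ X)
    (hmin : ∀ S : Set X, S.Nonempty → IsCompact S → h '' S = S → S = Set.univ)
    {K : Set X} (hne : K.Nonempty) (hK : IsCompact K) (hsub : h '' K ⊆ K) : K = Set.univ := by
  have hstep : ∀ n, (h : X → X)^[n + 1] '' K ⊆ (h : X → X)^[n] '' K := by
    intro n
    rw [Function.iterate_succ, image_comp]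
    exact image_mono hsub
  have hcomp : ∀ n, IsCompact ((h : X → X)^[n] '' K) := fun n =>
    hK.image (h.continuous.iterate n)
  have hI : (⋂ n, (h : X → X)^[n] '' K).Nonempty :=
    IsCompact.nonempty_iInter_of_sequence_nonempty_isCompact_isClosed _ hstep
      (fun n => hne.image _) (hcomp 0) (fun n => (hcomp n).isClosed)
  have hIsub : (⋂ n, (h : X → X)^[n] '' K) ⊆ K := by
    simpa using iInter_subset (fun n => (h : X → X)^[n] '' K) 0
  have hIcompact : IsCompact (⋂ n, (h : X → X)^[n] '' K) :=
    hK.of_isClosed_subset (isClosed_iInter fun n => (hcomp n).isClosed) hIsub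
  have hinv : h '' (⋂ n, (h : X → X)^[n] '' K) = ⋂ n, (h : X → X)^[n] '' K := by
    have himage : ∀ n, h '' ((h : X → X)^[n] '' K) = (h : X → X)^[n + 1] '' K := fun n => by
      rw [Function.iterate_succ', image_comp]
    rw [image_iInter h.bijective]
    simp only [himage]
    exact Subset.antisymm
      (iInter_mono fun n => hstep n)
      (subset_iInter fun n => iInter_subset _ (n + 1))
  have huniv := hmin _ hI hIcompact hinv
  exact univ_subset_iff.mp (huniv ▸ hIsub)

/-- Every forward orbit of a minimal homeomorphism of a compact space is dense. -/
theorem denseRange_iterate {X : Type*} [MetricSpace X] [CompactSpace X] (h : X ≃ₜ X)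
    (hmin : ∀ S : Set X, S.Nonempty → IsCompact S → h '' S = S → S = Set.univ) (x : X) :
    DenseRange fun n : ℕ => (h : X → X)^[n] x := by
  rw [DenseRange, dense_iff_closure_eq]
  refine eq_univ_of_image_subset h hmin (range_nonempty _).closure isClosed_closure.isCompact ?_
  rw [h.image_closure]
  refine closure_mono ?_
  rintro _ ⟨_, ⟨n, rfl⟩, rfl⟩
  exact ⟨n + 1, Function.iterate_succ_apply' _ _ _⟩

/-- The iterated Hutchinson operator of the IFS `{X; e, h}` collects the first iterates of `h`. -/
theorem hutch_refl_iterate {X : Type*} [MetricSpace X] (h : X ≃ₜ X) (S : Set X) (k : ℕ) :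
    (Hutch ![Homeomorph.refl X, h])^[k] S =
      ⋃ m ∈ Finset.range (k + 1), (h : X → X)^[m] '' S := by
  have hutch_eq : ∀ T : Set X, Hutch ![Homeomorph.refl X, h] T = T ∪ h '' T := by
    intro T
    ext y
    simp [Hutch, Fin.exists_fin_two]
  induction k with
  | zero => simp
  | succ k ih =>
    rw [Function.iterate_succ_apply', ih, hutch_eq]
    ext y
    simp only [mem_union, mem_image, mem_iUnion, Finset.mem_range, exists_prop]
    constructor
    · rintro (⟨m, hm, s, hs, rfl⟩ | ⟨_, ⟨m, hm, s, hs, rfl⟩, rfl⟩)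
      · exact ⟨m, by omega, s, hs, rfl⟩
      · exact ⟨m + 1, by omega, s, hs, Function.iterate_succ_apply' _ _ _⟩
    · rintro ⟨m, hm, s, hs, rfl⟩
      rcases m with _ | m
      · exact Or.inl ⟨0, by omega, s, hs, rfl⟩
      · exact Or.inr ⟨_, ⟨m, by omega, s, hs, rfl⟩, (Function.iterate_succ_apply' _ _ _).symm⟩

/-- For a minimal homeomorphism of a compact space, the unions of the first iterates of a nonempty
set converge to the whole space in the Hausdorff metric. -/
theorem tendsto_hausdorffDist_iUnion_iterate {X : Type*} [MetricSpace X] [CompactSpace X]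
    (h : X ≃ₜ X)
    (hmin : ∀ S : Set X, S.Nonempty → IsCompact S → h '' S = S → S = Set.univ)
    {S : Set X} (hS : S.Nonempty) :
    Tendsto
      (fun k => hausdorffDist (⋃ m ∈ Finset.range (k + 1), (h : X → X)^[m] '' S)
        (Set.univ : Set X))
      atTop (𝓝 0) := by
  obtain ⟨x, hx⟩ := hS
  rw [Metric.tendsto_atTop]
  intro ε hε
  obtain ⟨t, ht⟩ := isCompact_univ.elim_finite_subcover
    (fun n : ℕ => ball ((h : X → X)^[n] x) (ε / 2)) (fun _ => isOpen_ball) (by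
      intro y _
      obtain ⟨n, hn⟩ := (denseRange_iterate h hmin x).exists_dist_lt y (half_pos hε)
      exact mem_iUnion.mpr ⟨n, hn⟩)
  refine ⟨t.sup id, fun k hk => ?_⟩
  rw [Real.dist_0_eq_abs, abs_of_nonneg hausdorffDist_nonneg]
  refine lt_of_le_of_lt (hausdorffDist_le_of_mem_dist (half_pos hε).le
    (fun y _ => ⟨y, mem_univ y, by simpa using (half_pos hε).le⟩) fun y hy => ?_) (half_lt_self hε)
  obtain ⟨n, hn, hyn⟩ := mem_iUnion₂.mp (ht hy)
  have hnk : n ≤ k := (Finset.le_sup (f := id) hn).trans hk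
  exact ⟨_, mem_iUnion₂.mpr ⟨n, Finset.mem_range.mpr (Nat.lt_succ_of_le hnk), x, hx, rfl⟩,
    (mem_ball.mp hyn).le⟩

/-- if `X` is a nonempty compact metric space and `h : X → X` a homeomorphism
for which `X` is a minimal invariant set, then the IFS `{X; e, h}` has strict attractor
`A = X` with basin `B(A) = X`: for every nonempty compact `S`, the sets
`W^k(S) = ⋃_{0 ≤ m ≤ k} h^m(S)` converge to `X` in the Hausdorff metric. -/
theorem statement18 {X : Type*} [MetricSpace X] [CompactSpace X] [Nonempty X]
    (h : X ≃ₜ X)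
    (hmin : ∀ S : Set X, S.Nonempty → IsCompact S → h '' S = S → S = Set.univ) :
    IsStrictAttractor ![Homeomorph.refl X, h] (Set.univ : Set X) ∧
    AttractorBasin ![Homeomorph.refl X, h] (Set.univ : Set X) = Set.univ ∧
    ∀ S : Set X, S.Nonempty → IsCompact S →
      Tendsto
        (fun k => hausdorffDist (⋃ m ∈ Finset.range (k + 1), (h : X → X)^[m] '' S)
          (Set.univ : Set X))
        atTop (𝓝 0) := by
  have hattr : ∀ S : Set X, S.Nonempty → IsCompact S → S ⊆ Set.univ →
      Tendsto (fun k => hausdorffDist ((Hutch ![Homeomorph.refl X, h])^[k] S)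
        (Set.univ : Set X)) atTop (𝓝 0) := by
    intro S hS _ _
    simp only [hutch_refl_iterate]
    exact tendsto_hausdorffDist_iUnion_iterate h hmin hS
  exact ⟨⟨univ_nonempty, isCompact_univ, Set.univ, isOpen_univ, Subset.rfl, hattr⟩,
    univ_subset_iff.mp (subset_sUnion_of_mem ⟨isOpen_univ, Subset.rfl, hattr⟩),
    fun _ hS _ => tendsto_hausdorffDist_iUnion_iterate h hmin hS⟩
end FastBasinPaper
end
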